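/- arXiv:1905.00853 — 7 statements merged into one kernel-verified Lean document; each statement's English description precedes it below -/
import Mathlib

section
/- Let n ≥ 2 and consider an n-buyer second-price auction with interdependent valuations v : Fin n → Fin n → ℝ, with ties broken in favor of the lowest-index buyer. Fix a buyer i and set β := max over j ≠ i of (v i i − v i j), and assume β ≥ 0. Then, relative to the strategy sets S_j = [0,∞) for every buyer j ≠ i, every bid p > β of buyer i is weakly dominated by the bid β. -/
/-- The winner of the auction: among the buyers with maximal bid, the winner is the one
with the lowest index. -/
noncomputable def winnerLow {n : ℕ} (b : Fin (n + 1) → ℝ) : Fin (n + 1) :=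
  (Finset.univ.filter fun i => ∀ j, b j ≤ b i).min' (by
    obtain ⟨i, -, hi⟩ := Finset.exists_max_image (Finset.univ : Finset (Fin (n + 1))) b
      ⟨0, Finset.mem_univ 0⟩
    exact ⟨i, Finset.mem_filter.mpr ⟨Finset.mem_univ i, fun j => hi j (Finset.mem_univ j)⟩⟩)

/-- The maximum bid among the buyers other than `w`. -/
noncomputable def secondPrice {n : ℕ} (b : Fin (n + 1) → ℝ) (w : Fin (n + 1)) : ℝ :=
  if h : (Finset.univ.erase w).Nonempty then (Finset.univ.erase w).sup' h b else 0

/-- Buyer `i`'s utility in the second-price auction with interdependent valuations `v`: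
if `i` wins it gets `v i i` minus the maximum bid of the other buyers, and if `j ≠ i`
wins then buyer `i` gets `v i j`. -/
noncomputable def utilSP {n : ℕ} (v : Fin (n + 1) → Fin (n + 1) → ℝ) (i : Fin (n + 1))
    (b : Fin (n + 1) → ℝ) : ℝ :=
  if i = winnerLow b then v i (winnerLow b) - secondPrice b (winnerLow b)
  else v i (winnerLow b)

/-- `s'` weakly dominates `s` for buyer `i` (with utility `u`) relative to the strategy
sets `S j` of the opponents `j ≠ i`. -/
def WeaklyDominates {n : ℕ} (u : (Fin (n + 1) → ℝ) → ℝ) (i : Fin (n + 1))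
    (S : Fin (n + 1) → Set ℝ) (s' s : ℝ) : Prop :=
  (∀ b : Fin (n + 1) → ℝ, (∀ j, j ≠ i → b j ∈ S j) →
    u (Function.update b i s) ≤ u (Function.update b i s')) ∧
  (∃ b : Fin (n + 1) → ℝ, (∀ j, j ≠ i → b j ∈ S j) ∧
    u (Function.update b i s) < u (Function.update b i s'))

theorem le_winnerLow {n : ℕ} (b : Fin (n + 1) → ℝ) (j : Fin (n + 1)) :
    b j ≤ b (winnerLow b) :=
  (Finset.mem_filter.mp (Finset.min'_mem (Finset.univ.filter fun i => ∀ j, b j ≤ b i) _)).2 j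

theorem winnerLow_le {n : ℕ} {b : Fin (n + 1) → ℝ} {k : Fin (n + 1)} (h : ∀ j, b j ≤ b k) :
    winnerLow b ≤ k :=
  Finset.min'_le _ _ (Finset.mem_filter.mpr ⟨Finset.mem_univ k, h⟩)

theorem le_secondPrice {n : ℕ} (b : Fin (n + 1) → ℝ) {w j : Fin (n + 1)} (h : j ≠ w) :
    b j ≤ secondPrice b w := by
  have hj : j ∈ Finset.univ.erase w := Finset.mem_erase.mpr ⟨h, Finset.mem_univ j⟩
  rw [secondPrice, dif_pos ⟨j, hj⟩]
  exact Finset.le_sup' b hj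

/-- The price a buyer faces does not depend on that buyer's own bid. -/
theorem secondPrice_update {n : ℕ} (b : Fin (n + 1) → ℝ) (i : Fin (n + 1)) (x y : ℝ) :
    secondPrice (Function.update b i x) i = secondPrice (Function.update b i y) i := by
  unfold secondPrice
  split_ifs with h
  · refine Finset.sup'_congr h rfl fun j hj => ?_
    simp [Function.update_of_ne (Finset.ne_of_mem_erase hj)]
  · rfl

/-- A buyer who wins still wins after raising the bid. -/
theorem winnerLow_update_of_lt {n : ℕ} {b : Fin (n + 1) → ℝ} {i : Fin (n + 1)} {x y : ℝ}
    (hxy : x < y) (h : winnerLow (Function.update b i x) = i) :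
    winnerLow (Function.update b i y) = i := by
  by_contra hne
  have h₁ := le_winnerLow (Function.update b i y) i
  have h₂ := le_winnerLow (Function.update b i x) (winnerLow (Function.update b i y))
  rw [h] at h₂
  simp only [Function.update_self, Function.update_of_ne hne] at h₁ h₂
  linarith

/-- If a buyer loses with both of two bids, the winner is the same in both cases. -/
theorem winnerLow_update_eq {n : ℕ} {b : Fin (n + 1) → ℝ} {i : Fin (n + 1)} {x y : ℝ}
    (hx : winnerLow (Function.update b i x) ≠ i) (hy : winnerLow (Function.update b i y) ≠ i) :
    winnerLow (Function.update b i x) = winnerLow (Function.update b i y) := by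
  have key : ∀ x y : ℝ, winnerLow (Function.update b i x) ≠ i →
      winnerLow (Function.update b i y) ≠ i →
      winnerLow (Function.update b i x) ≤ winnerLow (Function.update b i y) := by
    intro x y hx hy
    refine winnerLow_le fun j => ?_
    have h₁ := le_winnerLow (Function.update b i x) j
    have h₂ := le_winnerLow (Function.update b i y) (winnerLow (Function.update b i x))
    rw [Function.update_of_ne hx] at h₁ h₂
    rw [Function.update_of_ne hy] at h₂ ⊢
    exact h₁.trans h₂
  exact le_antisymm (key x y hx hy) (key y x hy hx)

theorem utilSP_of_eq {n : ℕ} (v : Fin (n + 1) → Fin (n + 1) → ℝ) {i : Fin (n + 1)}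
    {b : Fin (n + 1) → ℝ} (h : winnerLow b = i) :
    utilSP v i b = v i i - secondPrice b i := by
  rw [utilSP, if_pos h.symm, h]

theorem utilSP_of_ne {n : ℕ} (v : Fin (n + 1) → Fin (n + 1) → ℝ) {i : Fin (n + 1)}
    {b : Fin (n + 1) → ℝ} (h : winnerLow b ≠ i) :
    utilSP v i b = v i (winnerLow b) :=
  if_neg h.symm

/-- In a second-price auction with interdependent valuations among `n + 2 ≥ 2` buyers
(ties broken in favor of the lowest index), if `β = max_{j ≠ i} (v i i - v i j) ≥ 0`,
then relative to the strategy sets `S j = [0, ∞)` every bid `p > β` of buyer `i`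
is weakly dominated by the bid `β`. -/
theorem stmt0 (n : ℕ) (v : Fin (n + 2) → Fin (n + 2) → ℝ) (i : Fin (n + 2)) (β : ℝ)
    (hβdef : IsGreatest ((fun j => v i i - v i j) '' {j | j ≠ i}) β) (hβ : 0 ≤ β)
    (p : ℝ) (hp : β < p) :
    WeaklyDominates (utilSP v i) i (fun _ => Set.Ici (0 : ℝ)) β p := by
  have hval : ∀ j, j ≠ i → v i i - v i j ≤ β := fun j hj => hβdef.2 ⟨j, hj, rfl⟩
  refine ⟨fun b _ => ?_, fun _ => (β + p) / 2, fun j _ => ?_, ?_⟩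
  · by_cases h₁ : winnerLow (Function.update b i β) = i
    · rw [utilSP_of_eq v h₁, utilSP_of_eq v (winnerLow_update_of_lt hp h₁),
        secondPrice_update b i β p]
    · by_cases h₂ : winnerLow (Function.update b i p) = i
      · rw [utilSP_of_ne v h₁, utilSP_of_eq v h₂, secondPrice_update b i p β]
        have hβw := le_winnerLow (Function.update b i β) i
        rw [Function.update_self] at hβw
        linarith [hval _ h₁, le_secondPrice (Function.update b i β) h₁]
      · rw [utilSP_of_ne v h₁, utilSP_of_ne v h₂, winnerLow_update_eq h₁ h₂]
  · exact Set.mem_Ici.mpr (by linarith)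
  · obtain ⟨j, hj, -⟩ := hβdef.1
    have hj : j ≠ i := hj
    have hlose : winnerLow (Function.update (fun _ => (β + p) / 2) i β) ≠ i := by
      intro h
      have hle := le_winnerLow (Function.update (fun _ => (β + p) / 2) i β) j
      rw [h, Function.update_self, Function.update_of_ne hj] at hle
      linarith
    have hwin : winnerLow (Function.update (fun _ => (β + p) / 2) i p) = i := by
      by_contra h
      have hle := le_winnerLow (Function.update (fun _ => (β + p) / 2) i p) i
      rw [Function.update_self, Function.update_of_ne h] at hle
      linarith
    have hprice := le_secondPrice (Function.update (fun _ => (β + p) / 2) i p) hj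
    rw [Function.update_of_ne hj] at hprice
    rw [utilSP_of_ne v hlose, utilSP_of_eq v hwin]
    linarith [hval _ hlose]
end

section
/- Let n ≥ 2 and consider an n-buyer second-price auction with interdependent valuations v : Fin n → Fin n → ℝ, with ties broken in favor of the lowest-index buyer. Fix buyers i ≠ k and reals 0 ≤ p < q with q ≤ v i i − v i k. Then there is a profile of opponent bids b_{-i} with b_k ∈ (p, q) and b_j = 0 for all j ∉ {i, k}, such that buyer i's utility from bidding q against b_{-i} is strictly greater than its utility from bidding p against b_{-i}. In particular, the bid p does not weakly dominate the bid q for buyer i relative to any strategy sets (S_j)_{j≠i} with (p,q) ⊆ S_k and 0 ∈ S_j for all j ∉ {i,k}. -/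
theorem winnerLow_eq_of_forall_lt {n : ℕ} {b : Fin (n + 1) → ℝ} {w : Fin (n + 1)}
    (h : ∀ j, j ≠ w → b j < b w) : winnerLow b = w := by
  have hmem := Finset.min'_mem (Finset.univ.filter fun i => ∀ j, b j ≤ b i)
    ⟨w, Finset.mem_filter.mpr ⟨Finset.mem_univ w, fun j => by
      rcases eq_or_ne j w with rfl | hj
      · exact le_rfl
      · exact (h j hj).le⟩⟩
  by_contra hne
  exact absurd ((Finset.mem_filter.mp hmem).2 w) (not_le.mpr (h _ hne))

theorem secondPrice_eq_of_forall_le {n : ℕ} {b : Fin (n + 1) → ℝ} {w k : Fin (n + 1)}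
    (hk : k ≠ w) (h : ∀ j, j ≠ w → b j ≤ b k) : secondPrice b w = b k := by
  have hmem : k ∈ Finset.univ.erase w := Finset.mem_erase.mpr ⟨hk, Finset.mem_univ k⟩
  rw [secondPrice, dif_pos ⟨k, hmem⟩]
  exact le_antisymm (Finset.sup'_le _ _ fun j hj => h j (Finset.ne_of_mem_erase hj))
    (Finset.le_sup' b hmem)

theorem utilSP_of_forall_lt {n : ℕ} (v : Fin (n + 1) → Fin (n + 1) → ℝ)
    {b : Fin (n + 1) → ℝ} {i k : Fin (n + 1)} (hik : i ≠ k) (h : ∀ j, j ≠ k → b j < b k) :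
    utilSP v i b = v i k := by
  rw [utilSP, winnerLow_eq_of_forall_lt h, if_neg hik]

theorem utilSP_self_of_forall_lt {n : ℕ} (v : Fin (n + 1) → Fin (n + 1) → ℝ)
    {b : Fin (n + 1) → ℝ} {i k : Fin (n + 1)} (hki : k ≠ i) (h : ∀ j, j ≠ i → b j < b i)
    (hk : ∀ j, j ≠ i → b j ≤ b k) : utilSP v i b = v i i - b k := by
  rw [utilSP, winnerLow_eq_of_forall_lt h, if_pos rfl, secondPrice_eq_of_forall_le hki hk]

/-- If only the opponent `k` bids a positive amount, and this amount lies strictly between `p`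
and `q`, then buyer `i` gains by raising its bid from `p` to `q ≤ v i i - v i k`. -/
theorem utilSP_update_lt_update {n : ℕ} (v : Fin (n + 1) → Fin (n + 1) → ℝ)
    {i k : Fin (n + 1)} (hik : i ≠ k) {p q : ℝ} (hp : 0 ≤ p) (hq : q ≤ v i i - v i k)
    {b : Fin (n + 1) → ℝ} (hbk : b k ∈ Set.Ioo p q) (hb : ∀ j, j ≠ i → j ≠ k → b j = 0) :
    utilSP v i (Function.update b i p) < utilSP v i (Function.update b i q) := by
  obtain ⟨hpk, hkq⟩ := hbk
  have hle : ∀ j, j ≠ i → b j ≤ b k := fun j hji => by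
    rcases eq_or_ne j k with rfl | hjk
    · exact le_rfl
    · rw [hb j hji hjk]; linarith
  have hlow : utilSP v i (Function.update b i p) = v i k := by
    refine utilSP_of_forall_lt v hik fun j hjk => ?_
    rw [Function.update_of_ne hik.symm]
    rcases eq_or_ne j i with rfl | hji
    · rwa [Function.update_self]
    · rw [Function.update_of_ne hji, hb j hji hjk]; linarith
  have hhigh : utilSP v i (Function.update b i q) = v i i - b k := by
    rw [utilSP_self_of_forall_lt v hik.symm, Function.update_of_ne hik.symm]
    · intro j hji
      rw [Function.update_of_ne hji, Function.update_self]
      exact (hle j hji).trans_lt hkq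
    · intro j hji
      rw [Function.update_of_ne hji, Function.update_of_ne hik.symm]
      exact hle j hji
  rw [hlow, hhigh]
  linarith

/-- In a second-price auction with interdependent valuations among `n + 2 ≥ 2` buyers
(ties broken in favor of the lowest index), for buyers `i ≠ k` and reals
`0 ≤ p < q ≤ v i i - v i k`, there is a profile of opponent bids with `b k ∈ (p, q)`
and `b j = 0` for `j ∉ {i, k}` against which bidding `q` is strictly better for buyer `i`
than bidding `p`; in particular `p` does not weakly dominate `q` relative to any
strategy sets `S` with `(p, q) ⊆ S k` and `0 ∈ S j` for all `j ∉ {i, k}`. -/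
theorem stmt2 (n : ℕ) (v : Fin (n + 2) → Fin (n + 2) → ℝ) (i k : Fin (n + 2)) (hik : i ≠ k)
    (p q : ℝ) (hp : 0 ≤ p) (hpq : p < q) (hq : q ≤ v i i - v i k) :
    (∃ b : Fin (n + 2) → ℝ, b k ∈ Set.Ioo p q ∧ (∀ j, j ≠ i → j ≠ k → b j = 0) ∧
      utilSP v i (Function.update b i p) < utilSP v i (Function.update b i q)) ∧
    (∀ S : Fin (n + 2) → Set ℝ, Set.Ioo p q ⊆ S k →
      (∀ j, j ≠ i → j ≠ k → (0 : ℝ) ∈ S j) →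
      ¬ WeaklyDominates (utilSP v i) i S p q) := by
  obtain ⟨m, hm⟩ := exists_between hpq
  have hk : (Pi.single k m : Fin (n + 2) → ℝ) k ∈ Set.Ioo p q := by
    rwa [Pi.single_eq_same]
  have h0 : ∀ j, j ≠ i → j ≠ k → (Pi.single k m : Fin (n + 2) → ℝ) j = 0 :=
    fun j _ hjk => by rw [Pi.single_eq_of_ne hjk]
  have hlt := utilSP_update_lt_update v hik hp hq hk h0
  refine ⟨⟨Pi.single k m, hk, h0, hlt⟩, fun S hSk hS hdom => ?_⟩
  refine (hdom.1 (Pi.single k m) fun j hji => ?_).not_gt hlt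
  rcases eq_or_ne j k with rfl | hjk
  · exact hSk hk
  · rw [h0 j hji hjk]
    exact hS j hji hjk
end

section
/- Let n ≥ 2 and consider an n-buyer first-price auction with interdependent valuations v : Fin n → Fin n → ℝ, with ties broken in favor of the lowest-index buyer. Fix buyers i ≠ k and reals 0 ≤ p < q with q < v i i − v i k. Then there is a profile of opponent bids b_{-i} with b_k ∈ (p, q) and b_j = 0 for all j ∉ {i, k}, such that buyer i's utility from bidding q against b_{-i} is strictly greater than its utility from bidding p against b_{-i}. In particular, the bid p does not weakly dominate the bid q for buyer i relative to any strategy sets (S_j)_{j≠i} with (p,q) ⊆ S_k and 0 ∈ S_j for all j ∉ {i,k}. -/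
/-- Buyer `i`'s utility in the first-price auction with interdependent valuations `v`:
if `i` wins it gets `v i i` minus its own bid, and if `j ≠ i` wins then buyer `i`
gets `v i j`. -/
noncomputable def utilFP {n : ℕ} (v : Fin (n + 1) → Fin (n + 1) → ℝ) (i : Fin (n + 1))
    (b : Fin (n + 1) → ℝ) : ℝ :=
  if i = winnerLow b then v i (winnerLow b) - b (winnerLow b)
  else v i (winnerLow b)

/-- If buyer `k` bids strictly between `p` and `q` and the remaining opponents bid zero, then
buyer `i` strictly prefers winning with `q` to losing to `k` with `p`. -/
theorem utilFP_update_lt {n : ℕ} (v : Fin (n + 1) → Fin (n + 1) → ℝ) {i k : Fin (n + 1)}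
    (hik : i ≠ k) {p q : ℝ} (hp : 0 ≤ p) (hq : q < v i i - v i k) {b : Fin (n + 1) → ℝ}
    (hbk : b k ∈ Set.Ioo p q) (hb : ∀ j, j ≠ i → j ≠ k → b j = 0) :
    utilFP v i (Function.update b i p) < utilFP v i (Function.update b i q) := by
  obtain ⟨hpk, hkq⟩ := hbk
  have hwp : winnerLow (Function.update b i p) = k := by
    refine winnerLow_eq_of_forall_lt fun j hj => ?_
    rw [Function.update_of_ne hik.symm]
    rcases eq_or_ne j i with rfl | hji
    · simpa using hpk
    · rw [Function.update_of_ne hji, hb j hji hj]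
      linarith
  have hwq : winnerLow (Function.update b i q) = i := by
    refine winnerLow_eq_of_forall_lt fun j hj => ?_
    rw [Function.update_of_ne hj, Function.update_self]
    rcases eq_or_ne j k with rfl | hjk
    · exact hkq
    · rw [hb j hj hjk]
      linarith
  rw [utilFP, utilFP, hwp, hwq, if_neg hik, if_pos rfl, Function.update_self]
  linarith

/-- In a first-price auction with interdependent valuations among `n + 2 ≥ 2` buyers
(ties broken in favor of the lowest index), for buyers `i ≠ k` and reals
`0 ≤ p < q < v i i - v i k`, there is a profile of opponent bids with `b k ∈ (p, q)`
and `b j = 0` for `j ∉ {i, k}` against which bidding `q` is strictly better for buyer `i`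
than bidding `p`; in particular `p` does not weakly dominate `q` relative to any
strategy sets `S` with `(p, q) ⊆ S k` and `0 ∈ S j` for all `j ∉ {i, k}`. -/
theorem stmt4 (n : ℕ) (v : Fin (n + 2) → Fin (n + 2) → ℝ) (i k : Fin (n + 2)) (hik : i ≠ k)
    (p q : ℝ) (hp : 0 ≤ p) (hpq : p < q) (hq : q < v i i - v i k) :
    (∃ b : Fin (n + 2) → ℝ, b k ∈ Set.Ioo p q ∧ (∀ j, j ≠ i → j ≠ k → b j = 0) ∧
      utilFP v i (Function.update b i p) < utilFP v i (Function.update b i q)) ∧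
    (∀ S : Fin (n + 2) → Set ℝ, Set.Ioo p q ⊆ S k →
      (∀ j, j ≠ i → j ≠ k → (0 : ℝ) ∈ S j) →
      ¬ WeaklyDominates (utilFP v i) i S p q) := by
  obtain ⟨m, hm⟩ := exists_between hpq
  have hbk : Function.update (0 : Fin (n + 2) → ℝ) k m k ∈ Set.Ioo p q := by
    simpa using hm
  have hb : ∀ j, j ≠ i → j ≠ k → Function.update (0 : Fin (n + 2) → ℝ) k m j = 0 :=
    fun j _ hjk => by simp [hjk]
  have hlt := utilFP_update_lt v hik hp hq hbk hb
  refine ⟨⟨_, hbk, hb, hlt⟩, fun S hSk hS hdom => ?_⟩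
  refine absurd (hdom.1 _ fun j hji => ?_) (not_le.mpr hlt)
  rcases eq_or_ne j k with rfl | hjk
  · exact hSk hbk
  · rw [hb j hji hjk]
    exact hS j hji hjk
end

section
/- In the specific 3-buyer second-price auction with interdependent valuations given by v 1 1 = 2, v 1 2 = 1, v 1 3 = 0; v 2 1 = 0, v 2 2 = 4, v 2 3 = 1; v 3 1 = 0, v 3 2 = 1, v 3 3 = 6 (ties broken in favor of the lowest-index buyer), with strategy sets S_1 = S_2 = [0,∞) for Buyers 1 and 2: every bid y ∈ [0,5) of Buyer 3 is weakly dominated by the bid 5, and every bid y > 6 of Buyer 3 is weakly dominated by the bid 6. -/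
/-- The specific interdependent valuations: buyers `0, 1, 2` stand for Buyers `1, 2, 3`;
`v 0 = (2, 1, 0)`, `v 1 = (0, 4, 1)`, `v 2 = (0, 1, 6)`. -/
noncomputable def vA : Fin 3 → Fin 3 → ℝ := ![![2, 1, 0], ![0, 4, 1], ![0, 1, 6]]

/-- A buyer is the winner iff its bid is maximal and exceeds every bid of lower index. -/
theorem winnerLow_eq_iff {n : ℕ} (b : Fin (n + 1) → ℝ) (w : Fin (n + 1)) :
    winnerLow b = w ↔ (∀ j, b j ≤ b w) ∧ ∀ j < w, b j < b w := by
  unfold winnerLow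
  rw [Finset.min'_eq_iff]
  simp only [Finset.mem_filter, Finset.mem_univ, true_and]
  refine and_congr_right fun hw => ⟨fun h j hj => ?_, fun h j hj => ?_⟩
  · by_contra! hle
    exact absurd (h j fun k => (hw k).trans hle) (not_le.mpr hj)
  · by_contra! hlt
    exact absurd (hj w) (not_le.mpr (h j hlt))

theorem secondPrice_two (b : Fin 3 → ℝ) : secondPrice b 2 = max (b 0) (b 1) := by
  have h : (Finset.univ.erase (2 : Fin 3)) = {0, 1} := by decide
  simp [secondPrice, h]

/-- Buyer 3's utility in the auction `vA`, in terms of the three bids. -/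
theorem utilSP_vA_two (b : Fin 3 → ℝ) :
    utilSP vA 2 b =
      if max (b 0) (b 1) < b 2 then 6 - max (b 0) (b 1) else if b 1 ≤ b 0 then 0 else 1 := by
  split_ifs with h h'
  · have hw : winnerLow b = 2 := by
      rw [max_lt_iff] at h
      simp [winnerLow_eq_iff, Fin.forall_fin_succ, h.1, h.2, h.1.le, h.2.le]
    simp [utilSP, hw, secondPrice_two, vA]
  · have hw : winnerLow b = 0 := by
      have h2 : b 2 ≤ b 0 := by simpa [h'] using h
      simp [winnerLow_eq_iff, Fin.forall_fin_succ, h', h2]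
    simp [utilSP, hw, vA]
  · have hw : winnerLow b = 1 := by
      rw [not_le] at h'
      have h2 : b 2 ≤ b 1 := by simpa [max_eq_right h'.le] using h
      simp [winnerLow_eq_iff, Fin.forall_fin_succ, h', h'.le, h2]
    simp [utilSP, hw, vA]

theorem utilSP_vA_two_update (b : Fin 3 → ℝ) (s : ℝ) :
    utilSP vA 2 (Function.update b 2 s) =
      if max (b 0) (b 1) < s then 6 - max (b 0) (b 1) else if b 1 ≤ b 0 then 0 else 1 := by
  simp [utilSP_vA_two, Function.update]

/-- In the specific 3-buyer second-price auction `vA` (ties broken in favor of the lowest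
index), with strategy sets `[0, ∞)` for Buyers 1 and 2 (indices 0 and 1): every bid
`y ∈ [0, 5)` of Buyer 3 (index 2) is weakly dominated by the bid `5`, and every bid
`y > 6` of Buyer 3 is weakly dominated by the bid `6`. -/
theorem stmt5 :
    (∀ y ∈ Set.Ico (0 : ℝ) 5,
      WeaklyDominates (utilSP vA 2) 2 (fun _ => Set.Ici (0 : ℝ)) 5 y) ∧
    (∀ y : ℝ, 6 < y →
      WeaklyDominates (utilSP vA 2) 2 (fun _ => Set.Ici (0 : ℝ)) 6 y) := by
  refine ⟨fun y hy => ⟨fun b _ => ?_, fun _ => y, fun _ _ => hy.1, ?_⟩,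
    fun y hy => ⟨fun b _ => ?_, ![(6 + y) / 2, 0, 0], fun j _ => ?_, ?_⟩⟩
  · have := hy.2
    simp only [utilSP_vA_two_update]
    split_ifs <;> linarith
  · have := hy.2
    simp only [utilSP_vA_two_update, max_self, lt_irrefl, if_false, le_refl, if_true, this]
    linarith
  · simp only [utilSP_vA_two_update]
    split_ifs <;> linarith
  · have : 0 ≤ (6 + y) / 2 := by linarith
    fin_cases j <;> simp [this]
  · have h0 : max ((6 + y) / 2) 0 = (6 + y) / 2 := max_eq_left (by linarith)
    have h1 : (6 + y) / 2 < y := by linarith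
    have h2 : ¬ (6 + y) / 2 < 6 := by linarith
    have h3 : 0 ≤ (6 + y) / 2 := by linarith
    simp only [utilSP_vA_two_update, Matrix.cons_val_zero, Matrix.cons_val_one, h0, h1, h2, h3,
      if_true, if_false]
    linarith
end

section
/- In the specific 3-buyer second-price auction with interdependent valuations given by v 1 1 = 2, v 1 2 = 1, v 1 3 = 0; v 2 1 = 0, v 2 2 = 4, v 2 3 = 1; v 3 1 = 0, v 3 2 = 1, v 3 3 = 6 (ties broken in favor of the lowest-index buyer), with strategy sets S_2 = [0,∞) for Buyer 2 and S_3 = [0,6] \ [1,2] for Buyer 3: every bid x ∈ (1,2] of Buyer 1 is weakly dominated, relative to (S_2, S_3), by the bid 1. -/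
theorem winnerLow_eq {n : ℕ} {b : Fin (n + 1) → ℝ} {i : Fin (n + 1)}
    (hmax : ∀ j, b j ≤ b i) (hlow : ∀ k < i, b k < b i) : winnerLow b = i := by
  unfold winnerLow
  refine le_antisymm (Finset.min'_le _ _ (by simpa using hmax)) (Finset.le_min' _ _ _ ?_)
  intro k hk
  by_contra! hki
  exact ((Finset.mem_filter.mp hk).2 i).not_gt (hlow k hki)

theorem secondPrice_zero (b : Fin 3 → ℝ) : secondPrice b 0 = max (b 1) (b 2) := by
  have herase : (Finset.univ.erase 0 : Finset (Fin 3)) = {1, 2} := by decide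
  simp [secondPrice, herase]

theorem utilSP_vA_zero (b : Fin 3 → ℝ) (s : ℝ) :
    utilSP vA 0 (Function.update b 0 s) =
      if b 1 ≤ s ∧ b 2 ≤ s then 2 - max (b 1) (b 2) else if b 2 ≤ b 1 then 1 else 0 := by
  split_ifs with hwin hle
  · have hw : winnerLow (Function.update b 0 s) = 0 :=
      winnerLow_eq (by simp [Fin.forall_fin_succ, hwin]) (by simp)
    simp [utilSP, hw, secondPrice_zero, vA]
  · have hs : s < b 1 := by
      by_contra! h
      exact hwin ⟨h, hle.trans h⟩
    have hw : winnerLow (Function.update b 0 s) = 1 :=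
      winnerLow_eq (by simp [Fin.forall_fin_succ, hs.le, hle])
        (by simp [hs])
    simp [utilSP, hw, vA]
  · push Not at hle
    have hs : s < b 2 := by
      by_contra! h
      exact hwin ⟨hle.le.trans h, h⟩
    have hw : winnerLow (Function.update b 0 s) = 2 :=
      winnerLow_eq (by simp [Fin.forall_fin_succ, hs.le, hle.le])
        (by simp [Fin.forall_fin_succ, hs, hle])
    simp [utilSP, hw, vA]

/-- In the specific 3-buyer second-price auction `vA` (ties broken in favor of the lowest
index), with strategy sets `S 1 = [0, ∞)` for Buyer 2 and `S 2 = [0, 6] \ [1, 2]` for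
Buyer 3: every bid `x ∈ (1, 2]` of Buyer 1 (index 0) is weakly dominated by the bid `1`.
(The strategy set at index 0 is irrelevant for dominance for buyer 0.) -/
theorem stmt6 :
    ∀ x ∈ Set.Ioc (1 : ℝ) 2,
      WeaklyDominates (utilSP vA 0) 0
        ![Set.Ici (0 : ℝ), Set.Ici (0 : ℝ), Set.Icc (0 : ℝ) 6 \ Set.Icc 1 2] 1 x := by
  rintro x ⟨hx1, hx2⟩
  refine ⟨fun b hb => ?_, ![0, x, 0], ?_, ?_⟩
  · have hq : b 2 ∈ Set.Icc (0 : ℝ) 6 \ Set.Icc 1 2 := hb 2 (by decide)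
    have hq' : b 2 < 1 ∨ 2 < b 2 := by
      by_contra! h
      exact hq.2 h
    rw [utilSP_vA_zero, utilSP_vA_zero]
    have hmax := le_max_left (b 1) (b 2)
    grind
  · have hx0 : 0 ≤ x := by linarith
    simp [Fin.forall_fin_succ, hx0]
  · have hx0 : 0 ≤ x := by linarith
    rw [utilSP_vA_zero, utilSP_vA_zero]
    simp [hx0, hx1.not_ge]
    linarith
end

section
/- In the two-buyer second-price sequential auction with T items and nonnegative weakly decreasing marginal valuations, the equilibrium prices are weakly declining: for every node (x₁,x₂) with x₁ + x₂ ≤ T − 2, the equilibrium price satisfies p(x₁,x₂) ≥ p(W(x₁,x₂)), where W(x₁,x₂) is the winning child of (x₁,x₂). Consequently, along the equilibrium path from (0,0) the sequence of prices of the T items is weakly decreasing. -/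
/-- `Vsum v k = Σ_{ℓ=1}^{k} v ℓ` : the total value for winning `k` items, from the
marginal valuations `v`. -/
noncomputable def Vsum (v : ℕ → ℝ) (k : ℕ) : ℝ := ∑ ℓ ∈ Finset.range k, v (ℓ + 1)

open Classical in
/-- `eqPayoff v1 v2 r x1 x2` : the pair of equilibrium payoffs `(Π₁, Π₂)` at the node of
the two-buyer second-price sequential auction where `r` items remain for sale and buyer
`i` has already won `x_i` items (ties broken in favor of Buyer 1). -/
noncomputable def eqPayoff (v1 v2 : ℕ → ℝ) : ℕ → ℕ → ℕ → ℝ × ℝ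
  | 0, x1, x2 => (Vsum v1 x1, Vsum v2 x2)
  | r + 1, x1, x2 =>
    let A := eqPayoff v1 v2 r (x1 + 1) x2
    let B := eqPayoff v1 v2 r x1 (x2 + 1)
    if B.2 - A.2 ≤ A.1 - B.1 then (A.1 - (B.2 - A.2), A.2) else (B.1, B.2 - (A.1 - B.1))

/-- `d₁(x₁,x₂) = Π₁(x₁+1,x₂) − Π₁(x₁,x₂+1)` at a node whose children have `r` items
remaining: Buyer 1's value of winning the current item over losing it to Buyer 2. -/
noncomputable def eqD1 (v1 v2 : ℕ → ℝ) (r x1 x2 : ℕ) : ℝ :=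
  (eqPayoff v1 v2 r (x1 + 1) x2).1 - (eqPayoff v1 v2 r x1 (x2 + 1)).1

/-- `d₂(x₁,x₂) = Π₂(x₁,x₂+1) − Π₂(x₁+1,x₂)` at a node whose children have `r` items
remaining: Buyer 2's value of winning the current item over losing it to Buyer 1. -/
noncomputable def eqD2 (v1 v2 : ℕ → ℝ) (r x1 x2 : ℕ) : ℝ :=
  (eqPayoff v1 v2 r x1 (x2 + 1)).2 - (eqPayoff v1 v2 r (x1 + 1) x2).2

open Classical in
/-- The equilibrium price of the item sold at the node `(x1, x2)` with `r ≥ 1` items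
remaining: the losing buyer's drop-out value (ties won by Buyer 1). -/
noncomputable def eqPrice (v1 v2 : ℕ → ℝ) : ℕ → ℕ → ℕ → ℝ
  | 0, _, _ => 0
  | r + 1, x1, x2 =>
    if eqD2 v1 v2 r x1 x2 ≤ eqD1 v1 v2 r x1 x2 then eqD2 v1 v2 r x1 x2
    else eqD1 v1 v2 r x1 x2

open Classical in
/-- The winning child of the node `(x1, x2)` with `r ≥ 1` items remaining: `(x1+1, x2)`
if Buyer 1 wins the current item (`d₁ ≥ d₂`, ties to Buyer 1), else `(x1, x2+1)`. -/
noncomputable def eqWin (v1 v2 : ℕ → ℝ) : ℕ → ℕ → ℕ → ℕ × ℕ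
  | 0, x1, x2 => (x1, x2)
  | r + 1, x1, x2 =>
    if eqD2 v1 v2 r x1 x2 ≤ eqD1 v1 v2 r x1 x2 then (x1 + 1, x2) else (x1, x2 + 1)

/-- The equilibrium path of the sequential auction with `T` items, starting at `(0,0)`:
after `t` items have been sold the node is `eqPath v1 v2 T t` (which has `T - t` items
remaining). -/
noncomputable def eqPath (v1 v2 : ℕ → ℝ) (T : ℕ) : ℕ → ℕ × ℕ
  | 0 => (0, 0)
  | t + 1 => eqWin v1 v2 (T - t) (eqPath v1 v2 T t).1 (eqPath v1 v2 T t).2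

/-- Buyer 1 is as well off as if he won the current item and paid its price. -/
theorem eqPayoff_fst_eq_sub_price (v1 v2 : ℕ → ℝ) (r x1 x2 : ℕ) :
    (eqPayoff v1 v2 (r + 1) x1 x2).1 =
      (eqPayoff v1 v2 r (x1 + 1) x2).1 - eqPrice v1 v2 (r + 1) x1 x2 := by
  by_cases h : eqD2 v1 v2 r x1 x2 ≤ eqD1 v1 v2 r x1 x2
  · rw [eqPrice, if_pos h, eqPayoff, eqD2]
    exact (congrArg Prod.fst (if_pos h)).trans (by ring)
  · rw [eqPrice, if_neg h, eqPayoff, eqD1]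
    exact (congrArg Prod.fst (if_neg h)).trans (by ring)

/-- Buyer 2 is as well off as if he won the current item and paid its price. -/
theorem eqPayoff_snd_eq_sub_price (v1 v2 : ℕ → ℝ) (r x1 x2 : ℕ) :
    (eqPayoff v1 v2 (r + 1) x1 x2).2 =
      (eqPayoff v1 v2 r x1 (x2 + 1)).2 - eqPrice v1 v2 (r + 1) x1 x2 := by
  by_cases h : eqD2 v1 v2 r x1 x2 ≤ eqD1 v1 v2 r x1 x2
  · rw [eqPrice, if_pos h, eqPayoff, eqD2]
    exact (congrArg Prod.snd (if_pos h)).trans (by ring)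
  · rw [eqPrice, if_neg h, eqPayoff, eqD1]
    exact (congrArg Prod.snd (if_neg h)).trans (by ring)

/-- Buyer 1 does at least as well as by losing the current item. -/
theorem eqPayoff_fst_le_succ (v1 v2 : ℕ → ℝ) (r x1 x2 : ℕ) :
    (eqPayoff v1 v2 r x1 (x2 + 1)).1 ≤ (eqPayoff v1 v2 (r + 1) x1 x2).1 := by
  simp only [eqPayoff]
  split_ifs <;> linarith

/-- Buyer 2 does at least as well as by losing the current item. -/
theorem eqPayoff_snd_le_succ (v1 v2 : ℕ → ℝ) (r x1 x2 : ℕ) :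
    (eqPayoff v1 v2 r (x1 + 1) x2).2 ≤ (eqPayoff v1 v2 (r + 1) x1 x2).2 := by
  simp only [eqPayoff]
  split_ifs <;> linarith

/-- The price at a node is at least the price at its winning child. -/
theorem eqPrice_eqWin_le (v1 v2 : ℕ → ℝ) (r x1 x2 : ℕ) :
    eqPrice v1 v2 (r + 1) (eqWin v1 v2 (r + 2) x1 x2).1 (eqWin v1 v2 (r + 2) x1 x2).2
      ≤ eqPrice v1 v2 (r + 2) x1 x2 := by
  rw [eqWin, eqPrice.eq_2 v1 v2 x1 x2 (r + 1)]
  split_ifs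
  · rw [eqD2]
    linarith [eqPayoff_snd_eq_sub_price v1 v2 r (x1 + 1) x2,
      eqPayoff_snd_le_succ v1 v2 r x1 (x2 + 1)]
  · rw [eqD1]
    linarith [eqPayoff_fst_eq_sub_price v1 v2 r x1 (x2 + 1),
      eqPayoff_fst_le_succ v1 v2 r (x1 + 1) x2]

/-- Gale–Stegeman declining price anomaly: in the two-buyer second-price sequential
auction with `T` items and nonnegative weakly decreasing marginal valuations, for every
node `(x₁, x₂)` with `x₁ + x₂ ≤ T - 2` the equilibrium price at `(x₁, x₂)` is at least
the equilibrium price at its winning child; consequently the sequence of prices of the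
`T` items along the equilibrium path from `(0,0)` is weakly decreasing. -/
theorem stmt10 (T : ℕ) (v1 v2 : ℕ → ℝ)
    (h1 : ∀ ℓ, 1 ≤ ℓ → v1 (ℓ + 1) ≤ v1 ℓ ∧ 0 ≤ v1 (ℓ + 1))
    (h2 : ∀ ℓ, 1 ≤ ℓ → v2 (ℓ + 1) ≤ v2 ℓ ∧ 0 ≤ v2 (ℓ + 1)) :
    (∀ x1 x2 : ℕ, x1 + x2 + 2 ≤ T →
      eqPrice v1 v2 (T - (x1 + x2) - 1)
          (eqWin v1 v2 (T - (x1 + x2)) x1 x2).1 (eqWin v1 v2 (T - (x1 + x2)) x1 x2).2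
        ≤ eqPrice v1 v2 (T - (x1 + x2)) x1 x2) ∧
    (∀ t : ℕ, t + 2 ≤ T →
      eqPrice v1 v2 (T - (t + 1)) (eqPath v1 v2 T (t + 1)).1 (eqPath v1 v2 T (t + 1)).2
        ≤ eqPrice v1 v2 (T - t) (eqPath v1 v2 T t).1 (eqPath v1 v2 T t).2) := by
  refine ⟨fun x1 x2 h => ?_, fun t h => ?_⟩
  · obtain ⟨r, rfl⟩ := Nat.exists_eq_add_of_le h
    rw [show x1 + x2 + 2 + r - (x1 + x2) = r + 2 by omega]
    exact eqPrice_eqWin_le v1 v2 r x1 x2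
  · rw [eqPath, show T - (t + 1) = T - (t + 2) + 1 by omega,
      show T - t = T - (t + 2) + 2 by omega]
    exact eqPrice_eqWin_le v1 v2 (T - (t + 2)) _ _
end

section
/- In the two-buyer second-price sequential auction with T items and nonnegative weakly decreasing marginal valuations, in every subgame each buyer has a non-negative value from winning the current item against the other buyer: for every node (x₁,x₂) with x₁ + x₂ ≤ T − 1, one has d₁(x₁,x₂) ≥ 0 and d₂(x₁,x₂) ≥ 0; in particular every equilibrium price p(x₁,x₂) = min(d₁(x₁,x₂), d₂(x₁,x₂)) is non-negative. -/
theorem nonneg_of_antitone_marginals {v : ℕ → ℝ}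
    (h : ∀ ℓ, 1 ≤ ℓ → v (ℓ + 1) ≤ v ℓ ∧ 0 ≤ v (ℓ + 1)) (k : ℕ) : 0 ≤ v (k + 1) :=
  (h (k + 1) (by omega)).2.trans (h (k + 1) (by omega)).1

theorem eqPayoff_succ (v1 v2 : ℕ → ℝ) (r x1 x2 : ℕ) :
    eqPayoff v1 v2 (r + 1) x1 x2 =
      ((eqPayoff v1 v2 r x1 (x2 + 1)).1 + max 0 (eqD1 v1 v2 r x1 x2 - eqD2 v1 v2 r x1 x2),
        (eqPayoff v1 v2 r (x1 + 1) x2).2 +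
          max 0 (eqD2 v1 v2 r x1 x2 - eqD1 v1 v2 r x1 x2)) := by
  simp only [eqPayoff, eqD1, eqD2]
  split_ifs with h
  · rw [max_eq_right (by linarith), max_eq_left (by linarith)]
    ext <;> grind
  · rw [max_eq_left (by linarith), max_eq_right (by linarith)]
    ext <;> grind

/-- Buyer 1's value of winning is at least the next price after losing. -/
theorem min_le_eqD1_succ (v1 v2 : ℕ → ℝ) (r x1 x2 : ℕ) :
    min (eqD1 v1 v2 r x1 (x2 + 1)) (eqD2 v1 v2 r x1 (x2 + 1)) ≤ eqD1 v1 v2 (r + 1) x1 x2 := by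
  have hd : eqD1 v1 v2 r x1 (x2 + 1) =
      (eqPayoff v1 v2 r (x1 + 1) (x2 + 1)).1 - (eqPayoff v1 v2 r x1 (x2 + 1 + 1)).1 := rfl
  rw [eqD1.eq_def v1 v2 (r + 1), eqPayoff_succ, eqPayoff_succ]
  grind

/-- Buyer 2's value of winning is at least the next price after losing. -/
theorem min_le_eqD2_succ (v1 v2 : ℕ → ℝ) (r x1 x2 : ℕ) :
    min (eqD1 v1 v2 r (x1 + 1) x2) (eqD2 v1 v2 r (x1 + 1) x2) ≤ eqD2 v1 v2 (r + 1) x1 x2 := by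
  have hd : eqD2 v1 v2 r (x1 + 1) x2 =
      (eqPayoff v1 v2 r (x1 + 1) (x2 + 1)).2 - (eqPayoff v1 v2 r (x1 + 1 + 1) x2).2 := rfl
  rw [eqD2.eq_def v1 v2 (r + 1), eqPayoff_succ, eqPayoff_succ]
  grind

theorem eqD1_eqD2_nonneg {v1 v2 : ℕ → ℝ} (h1 : ∀ k, 0 ≤ v1 (k + 1)) (h2 : ∀ k, 0 ≤ v2 (k + 1))
    (r x1 x2 : ℕ) : 0 ≤ eqD1 v1 v2 r x1 x2 ∧ 0 ≤ eqD2 v1 v2 r x1 x2 := by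
  induction r generalizing x1 x2 with
  | zero => simp [eqD1, eqD2, eqPayoff, Vsum, Finset.sum_range_succ, h1, h2]
  | succ r ih =>
    obtain ⟨hA1, hA2⟩ := ih (x1 + 1) x2
    obtain ⟨hB1, hB2⟩ := ih x1 (x2 + 1)
    exact ⟨(le_min hB1 hB2).trans (min_le_eqD1_succ ..),
      (le_min hA1 hA2).trans (min_le_eqD2_succ ..)⟩

theorem eqPrice_succ (v1 v2 : ℕ → ℝ) (r x1 x2 : ℕ) :
    eqPrice v1 v2 (r + 1) x1 x2 = min (eqD1 v1 v2 r x1 x2) (eqD2 v1 v2 r x1 x2) := by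
  rw [eqPrice, min_comm, min_def]

/-- In the two-buyer second-price sequential auction with `T` items and nonnegative
weakly decreasing marginal valuations, in every subgame each buyer has a non-negative
value for winning the current item against the other buyer: at every node `(x₁, x₂)`
with `x₁ + x₂ ≤ T - 1` one has `d₁(x₁,x₂) ≥ 0` and `d₂(x₁,x₂) ≥ 0`; in particular the
equilibrium price there equals `min (d₁, d₂)` and is non-negative. -/
theorem stmt11 (T : ℕ) (v1 v2 : ℕ → ℝ)
    (h1 : ∀ ℓ, 1 ≤ ℓ → v1 (ℓ + 1) ≤ v1 ℓ ∧ 0 ≤ v1 (ℓ + 1))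
    (h2 : ∀ ℓ, 1 ≤ ℓ → v2 (ℓ + 1) ≤ v2 ℓ ∧ 0 ≤ v2 (ℓ + 1)) :
    ∀ x1 x2 : ℕ, x1 + x2 + 1 ≤ T →
      0 ≤ eqD1 v1 v2 (T - (x1 + x2) - 1) x1 x2 ∧
      0 ≤ eqD2 v1 v2 (T - (x1 + x2) - 1) x1 x2 ∧
      eqPrice v1 v2 (T - (x1 + x2)) x1 x2 =
        min (eqD1 v1 v2 (T - (x1 + x2) - 1) x1 x2) (eqD2 v1 v2 (T - (x1 + x2) - 1) x1 x2) ∧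
      0 ≤ eqPrice v1 v2 (T - (x1 + x2)) x1 x2 := by
  intro x1 x2 hx
  obtain ⟨r, hr⟩ : ∃ r, T - (x1 + x2) = r + 1 := ⟨T - (x1 + x2) - 1, by omega⟩
  obtain ⟨hd1, hd2⟩ := eqD1_eqD2_nonneg (nonneg_of_antitone_marginals h1)
    (nonneg_of_antitone_marginals h2) r x1 x2
  rw [hr, Nat.add_sub_cancel, eqPrice_succ]
  exact ⟨hd1, hd2, rfl, le_min hd1 hd2⟩
end
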